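/- Let α > 1, T > 0, let f be the Bessel kernel on ℝ³, and let 0 < ρ₁ < min(α−1, 1). Then there exists a constant C > 0 such that for all 0 < h ≤ 1, ∫₀^T ∫_{S²} ∫_{S²} |f(s(ξ+η) + h(ξ+η)) − f(s(ξ+η) + hη)| s σ(dξ) σ(dη) ds ≤ C h^{ρ₁}. -/

import Mathlib

open MeasureTheory Real
open scoped ENNReal

noncomputable section

abbrev E3 : Type := EuclideanSpace ℝ (Fin 3)

/-- The Bessel kernel on `ℝ³` with parameter `α`:
`f(x) = ∫₀^∞ w^{(α-5)/2} e^{-w} e^{-|x|²/(4w)} dw`. -/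
def besselKernel (α : ℝ) (x : E3) : ℝ :=
  ∫ w in Set.Ioi (0 : ℝ), w ^ ((α - 5) / 2) * Real.exp (-w) * Real.exp (-‖x‖ ^ 2 / (4 * w))

/-- Uniform surface measure on the unit sphere `S²` in `ℝ³` (total mass `4 π`),
viewed as a measure on `ℝ³`. -/
def sphereMeasure : Measure E3 :=
  Measure.map (fun x : Metric.sphere (0 : E3) 1 => (x : E3)) ((volume : Measure E3).toSphere)

/-- The Gaussian profile `exp (-a² / (4 w))` is `1 / √w`-Lipschitz in `a`. -/
lemma abs_exp_neg_sq_div_sub_le {w : ℝ} (hw : 0 < w) (a b : ℝ) :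
    |exp (-a ^ 2 / (4 * w)) - exp (-b ^ 2 / (4 * w))| ≤ |a - b| * w ^ (-(1 / 2) : ℝ) := by
  have lip (x y : ℝ) : |exp (-y ^ 2) - exp (-x ^ 2)| ≤ 1 * |y - x| := by
    refine Convex.norm_image_sub_le_of_norm_hasDerivWithin_le (s := Set.univ)
      (f := fun t : ℝ => exp (-t ^ 2)) (f' := fun t => exp (-t ^ 2) * (-(2 * t)))
      (fun t _ => ?_) (fun t _ => ?_) convex_univ trivial trivial
    · have := ((hasDerivAt_pow 2 t).neg).exp
      simpa using this
    · rw [Real.norm_eq_abs, abs_mul, abs_of_pos (exp_pos _), abs_neg, exp_neg,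
        inv_mul_le_iff₀ (exp_pos _), mul_one, abs_mul, abs_two]
      have := add_one_le_exp (t ^ 2)
      nlinarith [sq_nonneg (|t| - 1), sq_abs t]
  have hsq : w ^ (-(1 / 2) : ℝ) = (√w)⁻¹ := by rw [rpow_neg hw.le, sqrt_eq_rpow]
  have hs : 0 < √w := sqrt_pos.2 hw
  have key (c : ℝ) : -c ^ 2 / (4 * w) = -(c / (2 * √w)) ^ 2 := by
    rw [div_pow, mul_pow, sq_sqrt hw.le]; ring
  rw [key, key, hsq]
  refine (lip _ _).trans ?_
  rw [one_mul, ← sub_div, abs_div, abs_of_pos (by positivity : 0 < 2 * √w), ← div_eq_mul_inv]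
  gcongr
  linarith

lemma exp_neg_le_rpow_neg {y γ : ℝ} (hy : 0 < y) (h0 : 0 ≤ γ) (h1 : γ ≤ 1) :
    exp (-y) ≤ y ^ (-γ) := by
  rw [exp_neg, rpow_neg hy.le]
  gcongr
  have h : y ^ γ ≤ y + 1 := by
    rcases le_total y 1 with h | h
    · linarith [rpow_le_one hy.le h h0]
    · linarith [(rpow_le_rpow_of_exponent_le h h1).trans_eq (rpow_one y)]
  exact h.trans (add_one_le_exp y)

/-- Interpolation of the Lipschitz bound with the trivial bound for the Gaussian profile. -/
lemma abs_exp_neg_sq_div_sub_le_interpolate {w d a b h ρ γ : ℝ} (hw : 0 < w) (hd : 0 < d)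
    (ha : d ≤ a) (hb : d ≤ b) (hab : |a - b| ≤ h) (hρ0 : 0 < ρ) (hρ1 : ρ < 1)
    (hγ0 : 0 ≤ γ) (hγ1 : γ ≤ 1) :
    |exp (-a ^ 2 / (4 * w)) - exp (-b ^ 2 / (4 * w))| ≤
      ((1 - ρ) / 4) ^ (-γ) * h ^ ρ * d ^ (-(2 * γ)) * w ^ (γ - ρ / 2) := by
  set D := |exp (-a ^ 2 / (4 * w)) - exp (-b ^ 2 / (4 * w))| with hD
  have hD0 : 0 ≤ D := abs_nonneg _
  have hh : 0 ≤ h := (abs_nonneg _).trans hab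
  have hmono {c : ℝ} (hc : d ≤ c) : exp (-c ^ 2 / (4 * w)) ≤ exp (-d ^ 2 / (4 * w)) := by
    gcongr
  have hD1 : D ≤ exp (-d ^ 2 / (4 * w)) := by
    rw [hD, abs_le]
    constructor <;> linarith [hmono ha, hmono hb, exp_pos (-a ^ 2 / (4 * w)),
      exp_pos (-b ^ 2 / (4 * w))]
  have hD2 : D ≤ h * w ^ (-(1 / 2) : ℝ) :=
    (abs_exp_neg_sq_div_sub_le hw a b).trans (by gcongr)
  have hy : 0 < (1 - ρ) / 4 * (d ^ 2 * w⁻¹) := by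
    have : 0 < 1 - ρ := by linarith
    positivity
  have e1 : exp (-d ^ 2 / (4 * w)) ^ (1 - ρ) ≤ ((1 - ρ) / 4) ^ (-γ) * (d ^ (-(2 * γ)) * w ^ γ) := by
    rw [← exp_mul]
    have : -d ^ 2 / (4 * w) * (1 - ρ) = -((1 - ρ) / 4 * (d ^ 2 * w⁻¹)) := by
      field_simp
    rw [this]
    refine (exp_neg_le_rpow_neg hy hγ0 hγ1).trans_eq ?_
    rw [mul_rpow (by linarith) (by positivity), mul_rpow (by positivity) (by positivity),
      inv_rpow hw.le, ← rpow_neg hw.le, neg_neg, ← rpow_natCast d 2, ← rpow_mul hd.le]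
    norm_num
  have e2 : (h * w ^ (-(1 / 2) : ℝ)) ^ ρ = h ^ ρ * w ^ (-(ρ / 2)) := by
    rw [mul_rpow hh (by positivity), ← rpow_mul hw.le]
    ring_nf
  calc D = D ^ (1 - ρ) * D ^ ρ := by
        rw [← rpow_add_of_nonneg hD0 (by linarith) hρ0.le]; simp
    _ ≤ exp (-d ^ 2 / (4 * w)) ^ (1 - ρ) * (h * w ^ (-(1 / 2) : ℝ)) ^ ρ := by
        gcongr
    _ ≤ (((1 - ρ) / 4) ^ (-γ) * (d ^ (-(2 * γ)) * w ^ γ)) * (h ^ ρ * w ^ (-(ρ / 2))) := by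
        rw [e2]; gcongr
    _ = _ := by
        rw [sub_eq_add_neg γ, rpow_add hw]; ring

lemma integrableOn_besselKernel_integrand {p r : ℝ} (hp : -2 < p) (hr : 0 < r) :
    IntegrableOn (fun w : ℝ => w ^ p * exp (-w) * exp (-r ^ 2 / (4 * w))) (Set.Ioi 0) := by
  obtain ⟨γ, hγ, hγ1⟩ := exists_between (max_lt (by linarith : -1 - p < 1) one_pos)
  obtain ⟨hγp, hγ0⟩ := max_lt_iff.1 hγ
  have hG := (GammaIntegral_convergent (s := p + γ + 1) (by linarith)).const_mul ((r ^ 2 / 4) ^ (-γ))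
  refine hG.mono' (by fun_prop) ?_
  filter_upwards [ae_restrict_mem measurableSet_Ioi] with w hw
  have hw : 0 < w := hw
  rw [norm_of_nonneg (by positivity)]
  have h1 : exp (-r ^ 2 / (4 * w)) ≤ (r ^ 2 / 4) ^ (-γ) * w ^ γ := by
    have : -r ^ 2 / (4 * w) = -(r ^ 2 / 4 * w⁻¹) := by field_simp
    rw [this]
    refine (exp_neg_le_rpow_neg (by positivity) hγ0.le hγ1.le).trans_eq ?_
    rw [mul_rpow (by positivity) (by positivity), inv_rpow hw.le, ← rpow_neg hw.le, neg_neg]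
  calc _ ≤ w ^ p * exp (-w) * ((r ^ 2 / 4) ^ (-γ) * w ^ γ) := by gcongr
    _ = _ := by rw [add_sub_cancel_right, rpow_add hw]; ring

/-- Hölder estimate for the Bessel kernel away from the origin, with an explicit blow-up rate. -/
lemma exists_abs_besselKernel_sub_le {α ρ κ : ℝ} (hα : 1 < α) (hρ0 : 0 < ρ) (hρ1 : ρ < 1)
    (hκ0 : 0 < κ) (hκ2 : κ < 2) (hκ : 3 + ρ - α < κ) :
    ∃ C : ℝ, 0 < C ∧ ∀ (x y : E3) (d h : ℝ), 0 < d → d ≤ ‖x‖ → d ≤ ‖y‖ → ‖x - y‖ ≤ h →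
      |besselKernel α x - besselKernel α y| ≤ C * h ^ ρ * d ^ (-κ) := by
  set q := (α - 5) / 2 + (κ / 2 - ρ / 2) with hq
  have hq1 : 0 < q + 1 := by rw [hq]; linarith
  refine ⟨((1 - ρ) / 4) ^ (-(κ / 2)) * Gamma (q + 1),
    mul_pos (rpow_pos_of_pos (by linarith) _) (Gamma_pos_of_pos hq1), ?_⟩
  intro x y d h hd hx hy hxy
  have ix := integrableOn_besselKernel_integrand (p := (α - 5) / 2) (by linarith) (hd.trans_le hx)
  have iy := integrableOn_besselKernel_integrand (p := (α - 5) / 2) (by linarith) (hd.trans_le hy)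
  have hab : |‖x‖ - ‖y‖| ≤ h := (abs_norm_sub_norm_le x y).trans hxy
  rw [besselKernel, besselKernel, ← integral_sub ix iy, Gamma_eq_integral hq1]
  have hG := (GammaIntegral_convergent hq1).const_mul
    (((1 - ρ) / 4) ^ (-(κ / 2)) * h ^ ρ * d ^ (-κ))
  refine (norm_integral_le_of_norm_le (G := ℝ) hG ?_).trans_eq ?_
  · filter_upwards [ae_restrict_mem measurableSet_Ioi] with w hw
    have hw : 0 < w := hw
    rw [← mul_sub, norm_mul, norm_of_nonneg (by positivity), Real.norm_eq_abs]
    have := abs_exp_neg_sq_div_sub_le_interpolate (γ := κ / 2) hw hd hx hy hab hρ0 hρ1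
      (by linarith) (by linarith)
    calc _ ≤ w ^ ((α - 5) / 2) * exp (-w) * _ := mul_le_mul_of_nonneg_left this (by positivity)
      _ = _ := by
        rw [add_sub_cancel_right, hq, rpow_add hw, mul_div_cancel₀ κ two_ne_zero]; ring
  · rw [integral_const_mul]; ring

open scoped Pointwise in
lemma toSphere_singleton (ξ : Metric.sphere (0 : E3) 1) :
    (volume : Measure E3).toSphere {ξ} = 0 := by
  rw [Measure.toSphere_apply' _ (measurableSet_singleton _), Set.image_singleton]
  have hsub : Set.Ioo (0 : ℝ) 1 • ({(ξ : E3)} : Set E3) ⊆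
      ((ℝ ∙ (ξ : E3) : Submodule ℝ E3) : Set E3) := by
    rintro _ ⟨t, -, _, rfl, rfl⟩
    exact Submodule.smul_mem _ _ (Submodule.mem_span_singleton_self _)
  have hne : (ℝ ∙ (ξ : E3) : Submodule ℝ E3) ≠ ⊤ := by
    intro htop
    have h1 := finrank_span_singleton (K := ℝ) (v := (ξ : E3)) (ne_zero_of_mem_unit_sphere ξ)
    rw [htop, finrank_top] at h1
    simp at h1
  rw [measure_mono_null hsub (Measure.addHaar_submodule _ _ hne), mul_zero]

/-- Integration in polar coordinates for nonnegative functions. -/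
lemma lintegral_eq_lintegral_toSphere (G : E3 → ℝ≥0∞) (hG : Measurable G) :
    ∫⁻ x, G x = ∫⁻ ξ, ∫⁻ r, G ((r : ℝ) • (ξ : E3)) ∂(Measure.volumeIoiPow 2)
      ∂(volume : Measure E3).toSphere := by
  have hm := (volume : Measure E3).measurePreserving_homeomorphUnitSphereProd
  have hdim : Module.finrank ℝ E3 - 1 = 2 := by simp
  rw [hdim] at hm
  have hmeas : Measurable
      fun p : Metric.sphere (0 : E3) 1 × Set.Ioi (0 : ℝ) => G ((p.2 : ℝ) • (p.1 : E3)) :=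
    hG.comp (by fun_prop)
  rw [← lintegral_prod _ hmeas.aemeasurable, ← hm.lintegral_comp hmeas]
  calc ∫⁻ x, G x = ∫⁻ x in ({0}ᶜ : Set E3), G x := by rw [restrict_compl_singleton]
    _ = ∫⁻ x : ({0}ᶜ : Set E3), G x ∂((volume : Measure E3).comap (↑)) :=
      (lintegral_subtype_comap (measurableSet_singleton _).compl G).symm
    _ = _ := by
      refine lintegral_congr fun x => ?_
      congr 1
      exact congrArg Subtype.val ((homeomorphUnitSphereProd E3).symm_apply_apply x).symm

lemma lintegral_ball_norm_rpow_lt_top {κ : ℝ} (hκ : κ < 2) (R : ℝ) :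
    ∫⁻ x in Metric.ball (0 : E3) R, ENNReal.ofReal (‖x‖ ^ (-(κ + 1))) < ∞ := by
  suffices IntegrableOn (fun x : E3 => ‖x‖ ^ (-(κ + 1))) (Metric.ball 0 R) from this.lintegral_lt_top
  rw [integrableOn_fun_norm_addHaar volume (f := fun t : ℝ => t ^ (-(κ + 1)))]
  rcases le_or_gt R 0 with hR | hR
  · simp [Set.Ioo_eq_empty_of_le hR]
  refine ((intervalIntegral.integrableOn_Ioo_rpow_iff hR).2
    (by linarith : -1 < 1 - κ)).congr_fun (fun t ht => ?_) measurableSet_Ioo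
  have ht0 : 0 < t := ht.1
  rw [smul_eq_mul, ← rpow_natCast, ← rpow_add ht0]
  exact congrArg (t ^ ·) (by simp; ring)

lemma ofReal_le_volumeIoiPow_two {δ : ℝ} (h0 : 0 < δ) (h1 : δ < 1) :
    ENNReal.ofReal (δ / 3) ≤ Measure.volumeIoiPow 2
      {r : Set.Ioi (0 : ℝ) | 1 - δ ≤ (r : ℝ) ∧ (r : ℝ) < 1} := by
  let a : Set.Ioi (0 : ℝ) := ⟨1 - δ, sub_pos.2 h1⟩
  let b : Set.Ioi (0 : ℝ) := ⟨1, Set.mem_Ioi.2 one_pos⟩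
  have hset : {r : Set.Ioi (0 : ℝ) | 1 - δ ≤ (r : ℝ) ∧ (r : ℝ) < 1} = Set.Iio b \ Set.Iio a := by
    ext r
    simp [a, b, ← Subtype.coe_lt_coe, ← Subtype.coe_le_coe]
  have hab : Set.Iio a ⊆ Set.Iio b :=
    Set.Iio_subset_Iio (Subtype.coe_le_coe.1 (by simp [a, b, h0.le]))
  have hfin : Measure.volumeIoiPow 2 (Set.Iio a) ≠ ∞ := by
    rw [Measure.volumeIoiPow_apply_Iio]; exact ENNReal.ofReal_ne_top
  have ha0 : 0 ≤ 1 - δ := by linarith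
  rw [hset, measure_sdiff hab measurableSet_Iio.nullMeasurableSet hfin,
    Measure.volumeIoiPow_apply_Iio, Measure.volumeIoiPow_apply_Iio,
    ← ENNReal.ofReal_sub _ (by positivity)]
  refine ENNReal.ofReal_le_ofReal ?_
  simp only [a, b]
  norm_num
  nlinarith [mul_nonneg ha0 h0.le, mul_nonneg (mul_nonneg ha0 h0.le) ha0]

/-- The singular function `ξ ↦ ‖ξ + η‖ ^ (-κ)` with `κ < 2` is integrable over the unit sphere,
uniformly over unit vectors `η`. -/
lemma exists_lintegral_toSphere_norm_add_rpow_le {κ : ℝ} (hκ0 : 0 < κ) (hκ2 : κ < 2) :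
    ∃ K : ℝ≥0∞, K ≠ ∞ ∧ ∀ η : Metric.sphere (0 : E3) 1,
      ∫⁻ ξ : Metric.sphere (0 : E3) 1, ENNReal.ofReal (‖(η : E3) + ξ‖ ^ (-κ))
        ∂(volume : Measure E3).toSphere ≤ K := by
  set c : ℝ := 2 ^ (-(κ + 1)) / 12 with hc
  have hc0 : 0 < c := by positivity
  refine ⟨(ENNReal.ofReal c)⁻¹ *
    ∫⁻ x in Metric.ball (0 : E3) 3, ENNReal.ofReal (‖x‖ ^ (-(κ + 1))),
    ENNReal.mul_ne_top (by simpa using hc0) (lintegral_ball_norm_rpow_lt_top hκ2 3).ne, ?_⟩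
  intro η
  have hη : ‖(η : E3)‖ = 1 := norm_eq_of_mem_sphere η
  let F : E3 → ℝ≥0∞ :=
    (Metric.ball (0 : E3) 3).indicator fun x => ENNReal.ofReal (‖x‖ ^ (-(κ + 1)))
  have hF : Measurable F := Measurable.indicator (by fun_prop) measurableSet_ball
  have hvol : ∫⁻ x in Metric.ball (0 : E3) 3, ENNReal.ofReal (‖x‖ ^ (-(κ + 1))) =
      ∫⁻ ξ, ∫⁻ r, F ((r : ℝ) • (ξ : E3) + η) ∂(Measure.volumeIoiPow 2)
        ∂(volume : Measure E3).toSphere := by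
    rw [← lintegral_eq_lintegral_toSphere (fun x => F (x + η)) (hF.comp (by fun_prop)),
      lintegral_add_right_eq_self F (η : E3), lintegral_indicator measurableSet_ball]
  rw [hvol, ← ENNReal.mul_le_iff_le_inv (by simpa using hc0) ENNReal.ofReal_ne_top,
    ← lintegral_const_mul' _ _ ENNReal.ofReal_ne_top]
  refine lintegral_mono fun ξ => ?_
  have hξ : ‖(ξ : E3)‖ = 1 := norm_eq_of_mem_sphere ξ
  set d := ‖(η : E3) + ξ‖ with hd
  rcases (norm_nonneg ((η : E3) + ξ)).eq_or_lt with h0 | hd0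
  · rw [← hd] at h0
    simp [← h0, zero_rpow (neg_ne_zero.2 hκ0.ne')]
  rw [← hd] at hd0
  have hd2 : d ≤ 2 := (norm_add_le _ _).trans (by rw [hη, hξ]; norm_num)
  let S : Set (Set.Ioi (0 : ℝ)) := {r | 1 - d / 4 ≤ (r : ℝ) ∧ (r : ℝ) < 1}
  have hS : MeasurableSet S :=
    (measurableSet_le measurable_const measurable_subtype_coe).inter
      (measurableSet_lt measurable_subtype_coe measurable_const)
  have hlow : ∀ r ∈ S, ENNReal.ofReal ((2 * d) ^ (-(κ + 1))) ≤ F ((r : ℝ) • (ξ : E3) + η) := by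
    rintro r ⟨hr1, hr2⟩
    have hdiff : ‖((r : ℝ) • (ξ : E3) + η) - ((η : E3) + ξ)‖ = 1 - r := by
      have : ((r : ℝ) • (ξ : E3) + η) - ((η : E3) + ξ) = ((r : ℝ) - 1) • (ξ : E3) := by module
      rw [this, norm_smul, hξ, mul_one, norm_eq_abs, abs_sub_comm, abs_of_nonneg (by linarith)]
    obtain ⟨hl, hu⟩ := abs_le.1 (abs_norm_sub_norm_le ((r : ℝ) • (ξ : E3) + η) ((η : E3) + ξ))
    rw [hdiff, ← hd] at hl hu
    have hmem : (r : ℝ) • (ξ : E3) + η ∈ Metric.ball (0 : E3) 3 := by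
      rw [mem_ball_zero_iff]; linarith
    simp only [F, Set.indicator_of_mem hmem]
    refine ENNReal.ofReal_le_ofReal (rpow_le_rpow_of_nonpos ?_ ?_ ?_) <;> linarith
  calc ENNReal.ofReal c * ENNReal.ofReal (d ^ (-κ))
      = ENNReal.ofReal ((2 * d) ^ (-(κ + 1))) * ENNReal.ofReal (d / 4 / 3) := by
        rw [← ENNReal.ofReal_mul hc0.le, ← ENNReal.ofReal_mul (by positivity)]
        congr 1
        rw [mul_rpow zero_le_two hd0.le, hc, neg_add κ 1, rpow_add hd0, rpow_neg_one]
        field_simp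
        norm_num
    _ ≤ ENNReal.ofReal ((2 * d) ^ (-(κ + 1))) * Measure.volumeIoiPow 2 S := by
        gcongr
        exact ofReal_le_volumeIoiPow_two (by linarith) (by linarith)
    _ = ∫⁻ _ in S, ENNReal.ofReal ((2 * d) ^ (-(κ + 1))) ∂(Measure.volumeIoiPow 2) :=
        (setLIntegral_const _ _).symm
    _ ≤ ∫⁻ r in S, F ((r : ℝ) • (ξ : E3) + η) ∂(Measure.volumeIoiPow 2) :=
        setLIntegral_mono' hS hlow
    _ ≤ _ := setLIntegral_le_lintegral _ _

lemma lintegral_sphereMeasure (G : E3 → ℝ≥0∞) :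
    ∫⁻ x, G x ∂sphereMeasure =
      ∫⁻ ξ : Metric.sphere (0 : E3) 1, G ξ ∂(volume : Measure E3).toSphere :=
  (MeasurableEmbedding.subtype_coe Metric.isClosed_sphere.measurableSet).lintegral_map G

lemma mul_norm_add_le_norm_smul_add_smul {ξ η : E3} (hξ : ‖ξ‖ = 1) (hη : ‖η‖ = 1) {s h : ℝ}
    (hs : 0 ≤ s) (hh : 0 ≤ h) : s * ‖ξ + η‖ ≤ ‖s • (ξ + η) + h • η‖ := by
  have hin : 0 ≤ inner ℝ (ξ + η) η := by
    rw [inner_add_left, real_inner_self_eq_norm_sq, hη]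
    have := abs_le.1 (abs_real_inner_le_norm ξ η)
    rw [hξ, hη] at this
    linarith [this.1]
  refine le_of_sq_le_sq ?_ (norm_nonneg _)
  rw [norm_add_sq_real, norm_smul, norm_of_nonneg hs, real_inner_smul_left, real_inner_smul_right]
  have : 0 ≤ s * (h * inner ℝ (ξ + η) η) := by positivity
  nlinarith [sq_nonneg ‖h • η‖]

/-- Proposition 5.3, condition (4.1) for the Bessel kernel: for `α > 1` and
`0 < ρ₁ < min(α-1, 1)` there is `C > 0` such that for all `0 < h ≤ 1`,
`∫₀^T ∫_{S²} ∫_{S²} |f(s(ξ+η)+h(ξ+η)) - f(s(ξ+η)+hη)| s σ(dξ) σ(dη) ds ≤ C h^{ρ₁}`. -/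
theorem bessel_time_condition_one
    (α T ρ₁ : ℝ) (hα : 1 < α) (hT : 0 < T)
    (hρ0 : 0 < ρ₁) (hρ1 : ρ₁ < min (α - 1) 1) :
    ∃ C : ℝ, 0 < C ∧ ∀ h : ℝ, 0 < h → h ≤ 1 →
      (∫⁻ s in Set.Ioc (0 : ℝ) T, ∫⁻ ξ, ∫⁻ η,
          ENNReal.ofReal
            (|besselKernel α (s • (ξ + η) + h • (ξ + η))
                - besselKernel α (s • (ξ + η) + h • η)| * s)
        ∂sphereMeasure ∂sphereMeasure)
      ≤ ENNReal.ofReal (C * h ^ ρ₁) := by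
  have hρ1' : ρ₁ < 1 := hρ1.trans_le (min_le_right _ _)
  have hρα : ρ₁ < α - 1 := hρ1.trans_le (min_le_left _ _)
  obtain ⟨κ, hκ, hκ2⟩ := exists_between (max_lt (by linarith : 3 + ρ₁ - α < 2) two_pos)
  obtain ⟨hκα, hκ0⟩ := max_lt_iff.1 hκ
  obtain ⟨C, hC, hf⟩ := exists_abs_besselKernel_sub_le hα hρ0 hρ1' hκ0 hκ2 hκα
  obtain ⟨K, hK, hKη⟩ := exists_lintegral_toSphere_norm_add_rpow_le hκ0 hκ2
  set σ := (volume : Measure E3).toSphere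
  set J := ∫⁻ s in Set.Ioc (0 : ℝ) T, ENNReal.ofReal (s ^ (1 - κ))
  have hJtop : J ≠ ∞ :=
    (((intervalIntegral.intervalIntegrable_rpow' (by linarith : -1 < 1 - κ)).1 :
      IntegrableOn (fun s : ℝ => s ^ (1 - κ)) (Set.Ioc 0 T)).lintegral_lt_top).ne
  set M := J * (K * σ Set.univ) with hM
  have hMtop : M ≠ ∞ := ENNReal.mul_ne_top hJtop (ENNReal.mul_ne_top hK (measure_ne_top _ _))
  refine ⟨C * (M.toReal + 1), by positivity, fun h hh0 _ => ?_⟩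
  have hpt (s : ℝ) (hs : 0 < s) (ξ η : Metric.sphere (0 : E3) 1) (hne : (ξ : E3) + η ≠ 0) :
      |besselKernel α (s • ((ξ : E3) + η) + h • ((ξ : E3) + η))
        - besselKernel α (s • ((ξ : E3) + η) + h • (η : E3))| * s
      ≤ C * h ^ ρ₁ * s ^ (1 - κ) * ‖(ξ : E3) + η‖ ^ (-κ) := by
    have hξ : ‖(ξ : E3)‖ = 1 := norm_eq_of_mem_sphere ξ
    have hη : ‖(η : E3)‖ = 1 := norm_eq_of_mem_sphere η
    have hn : 0 < ‖(ξ : E3) + η‖ := norm_pos_iff.2 hne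
    have key := hf (s • ((ξ : E3) + η) + h • ((ξ : E3) + η)) (s • ((ξ : E3) + η) + h • (η : E3))
      (s * ‖(ξ : E3) + η‖) h (by positivity) ?_
      (mul_norm_add_le_norm_smul_add_smul hξ hη hs.le hh0.le) ?_
    · calc _ ≤ C * h ^ ρ₁ * (s * ‖(ξ : E3) + η‖) ^ (-κ) * s := by gcongr
        _ = _ := by
          rw [mul_rpow hs.le hn.le, sub_eq_add_neg, rpow_add hs, rpow_one]; ring
    · rw [← add_smul, norm_smul, norm_of_nonneg (by positivity)]
      gcongr
      linarith
    · rw [add_sub_add_left_eq_sub, ← smul_sub, add_sub_cancel_right, norm_smul, hξ,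
        norm_of_nonneg hh0.le, mul_one]
  have hA0 : 0 ≤ C * h ^ ρ₁ := by positivity
  have hinner (s : ℝ) (hs : 0 < s) (ξ : Metric.sphere (0 : E3) 1) :
      ∫⁻ η : Metric.sphere (0 : E3) 1, ENNReal.ofReal
        (|besselKernel α (s • ((ξ : E3) + η) + h • ((ξ : E3) + η))
          - besselKernel α (s • ((ξ : E3) + η) + h • (η : E3))| * s) ∂σ
      ≤ ENNReal.ofReal (C * h ^ ρ₁) * (ENNReal.ofReal (s ^ (1 - κ)) * K) := by
    have hnull : ∀ᵐ η ∂σ, η ≠ -ξ := measure_eq_zero_iff_ae_notMem.1 (toSphere_singleton (-ξ))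
    calc _ ≤ ∫⁻ η : Metric.sphere (0 : E3) 1, ENNReal.ofReal (C * h ^ ρ₁ * s ^ (1 - κ)) *
          ENNReal.ofReal (‖(ξ : E3) + η‖ ^ (-κ)) ∂σ := by
          refine lintegral_mono_ae ?_
          filter_upwards [hnull] with η hη
          rw [← ENNReal.ofReal_mul (by positivity)]
          refine ENNReal.ofReal_le_ofReal (hpt s hs ξ η fun h0 => hη ?_)
          exact Subtype.ext (eq_neg_of_add_eq_zero_right h0)
      _ ≤ ENNReal.ofReal (C * h ^ ρ₁ * s ^ (1 - κ)) * K := by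
          rw [lintegral_const_mul' _ _ ENNReal.ofReal_ne_top]
          gcongr
          exact hKη ξ
      _ = _ := by rw [ENNReal.ofReal_mul hA0, mul_assoc]
  simp only [lintegral_sphereMeasure]
  calc _ ≤ ∫⁻ s in Set.Ioc (0 : ℝ) T, ENNReal.ofReal (s ^ (1 - κ)) *
        (ENNReal.ofReal (C * h ^ ρ₁) * (K * σ Set.univ)) := by
        refine setLIntegral_mono' measurableSet_Ioc fun s hs => ?_
        refine (lintegral_mono fun ξ => hinner s hs.1 ξ).trans_eq ?_
        rw [lintegral_const]
        ring
    _ = ENNReal.ofReal (C * h ^ ρ₁) * M := by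
        rw [lintegral_mul_const' _ _ (ENNReal.mul_ne_top ENNReal.ofReal_ne_top
          (ENNReal.mul_ne_top hK (measure_ne_top _ _))), hM]
        ring
    _ ≤ ENNReal.ofReal (C * h ^ ρ₁) * ENNReal.ofReal (M.toReal + 1) := by
        gcongr
        rw [← ENNReal.ofReal_toReal hMtop]
        exact ENNReal.ofReal_le_ofReal (by simp)
    _ = _ := by
        rw [← ENNReal.ofReal_mul hA0]
        ring_nf
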